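/- arXiv:1105.0203 — 8 statements merged into one kernel-verified Lean document; each statement's English description precedes it below -/
import Mathlib

section
/- Let u_p, u_m, r_p, r_m, c_pp, c_pm, c_mp, c_mm be real numbers, set c_up = u_p − r_p·c_pp and c_um = u_m + r_m·c_mm, and let M be the real 4×4 matrix with rows (c_up, r_p, −r_p·c_pm, 0), (0, u_p, 0, 0), (r_m·c_mp, 0, c_um, −r_m), (0, 0, 0, u_m). Then the characteristic polynomial of M equals (X − u_p)·(X − u_m)·(X² − (c_up + c_um)·X + (c_up·c_um + r_p·r_m·c_pm·c_mp)). In particular, if Δ = (c_up − c_um)² − 4·r_p·r_m·c_pm·c_mp ≥ 0, the roots of the characteristic polynomial of M are exactly u_p, u_m and λ± = (1/2)(c_up + c_um ± √Δ). -/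
open Matrix Polynomial

theorem stmt3 (u_p u_m r_p r_m c_pp c_pm c_mp c_mm : ℝ)
    (c_up c_um : ℝ)
    (hcup : c_up = u_p - r_p * c_pp) (hcum : c_um = u_m + r_m * c_mm)
    (M : Matrix (Fin 4) (Fin 4) ℝ)
    (hM : M = !![c_up, r_p, -(r_p * c_pm), 0;
                 0, u_p, 0, 0;
                 r_m * c_mp, 0, c_um, -r_m;
                 0, 0, 0, u_m])
    (Δ : ℝ) (hΔdef : Δ = (c_up - c_um) ^ 2 - 4 * r_p * r_m * c_pm * c_mp) :
    Matrix.charpoly M =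
      (X - C u_p) * (X - C u_m) *
        (X ^ 2 - C (c_up + c_um) * X + C (c_up * c_um + r_p * r_m * c_pm * c_mp))
    ∧ (0 ≤ Δ → ∀ lam : ℝ, (Matrix.charpoly M).IsRoot lam ↔
        lam = u_p ∨ lam = u_m ∨
        lam = (1 / 2) * (c_up + c_um + Real.sqrt Δ) ∨
        lam = (1 / 2) * (c_up + c_um - Real.sqrt Δ)) := by
  have hchar : Matrix.charpoly M =
      (X - C u_p) * (X - C u_m) *
        (X ^ 2 - C (c_up + c_um) * X +
          C (c_up * c_um + r_p * r_m * c_pm * c_mp)) := by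
    subst hM
    simp [Matrix.charpoly, Matrix.charmatrix, Matrix.det_succ_row_zero, Fin.sum_univ_succ,
      Fin.succAbove]
    ring
  refine ⟨hchar, fun hΔ lam => ?_⟩
  have hquad : lam ^ 2 - (c_up + c_um) * lam + (c_up * c_um + r_p * r_m * c_pm * c_mp) =
      (lam - (1 / 2) * (c_up + c_um + Real.sqrt Δ)) *
        (lam - (1 / 2) * (c_up + c_um - Real.sqrt Δ)) := by
    linear_combination (1 / 4) * Real.sq_sqrt hΔ + (1 / 4) * hΔdef
  rw [hchar, IsRoot.def]
  simp only [eval_mul, eval_add, eval_sub, eval_pow, eval_X, eval_C]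
  rw [hquad]
  simp only [mul_eq_zero, sub_eq_zero, or_assoc]
end

section
/- Let p : ℝ → ℝ be differentiable and let ρ, u, w : ℝ → ℝ → ℝ be continuously differentiable functions of (t,x) with ρ(t,x) > 0 everywhere, satisfying at every point ∂_t ρ + ∂_x(ρ u) = 0, ∂_t(ρ w) + ∂_x(ρ w u) = 0 and w = u + p(ρ). Then at every point, ∂_t(ρ u) + ∂_x(ρ u w) = (ρ p'(ρ) + p(ρ)) · ∂_x(ρ u). -/
theorem stmt7 (p : ℝ → ℝ) (ρ u w : ℝ → ℝ → ℝ)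
    (hp : Differentiable ℝ p)
    (hρ : ContDiff ℝ 1 (Function.uncurry ρ))
    (hu : ContDiff ℝ 1 (Function.uncurry u))
    (hw : ContDiff ℝ 1 (Function.uncurry w))
    (hρpos : ∀ t x : ℝ, 0 < ρ t x)
    (hmass : ∀ t x : ℝ,
      deriv (fun τ => ρ τ x) t + deriv (fun y => ρ t y * u t y) x = 0)
    (hmom : ∀ t x : ℝ,
      deriv (fun τ => ρ τ x * w τ x) t
        + deriv (fun y => ρ t y * w t y * u t y) x = 0)
    (hclos : ∀ t x : ℝ, w t x = u t x + p (ρ t x)) :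
    ∀ t x : ℝ,
      deriv (fun τ => ρ τ x * u τ x) t
        + deriv (fun y => ρ t y * u t y * w t y) x
      = (ρ t x * deriv p (ρ t x) + p (ρ t x))
          * deriv (fun y => ρ t y * u t y) x := by
  intro t x
  have slice {f : ℝ → ℝ → ℝ} (hf : ContDiff ℝ 1 (Function.uncurry f)) :
      DifferentiableAt ℝ (fun τ => f τ x) t :=
    ((hf.differentiable one_ne_zero).comp
      (differentiable_id.prodMk (differentiable_const x))) t
  have hρt := (slice hρ).hasDerivAt
  have hwt := (slice hw).hasDerivAt
  have hpt := (hp (ρ t x)).hasDerivAt.comp t hρt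
  have hsplit : (fun τ => ρ τ x * u τ x) = fun τ => ρ τ x * w τ x - ρ τ x * p (ρ τ x) := by
    funext τ
    rw [hclos τ x]
    ring
  have hflux : (fun y => ρ t y * u t y * w t y) = fun y => ρ t y * w t y * u t y := by
    funext y
    ring
  have hρu : deriv (fun τ => ρ τ x * u τ x) t
      = deriv (fun τ => ρ τ x * w τ x) t
        - (deriv (fun τ => ρ τ x) t * p (ρ t x)
          + ρ t x * (deriv p (ρ t x) * deriv (fun τ => ρ τ x) t)) := by
    rw [hsplit]
    exact ((hρt.mul hwt).differentiableAt.hasDerivAt.sub (hρt.mul hpt)).deriv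
  rw [hρu, hflux]
  linear_combination hmom t x - (ρ t x * deriv p (ρ t x) + p (ρ t x)) * hmass t x
end

section
/- Let p : ℝ → ℝ be differentiable, V ∈ ℝ, and let ρ, u : ℝ → ℝ → ℝ be continuously differentiable functions of (t,x) satisfying at every point ∂_t ρ + ∂_x(ρ u) = 0 and ∂_t(ρ u) + ∂_x(ρ u V) = (ρ p'(ρ) + p(ρ)) · ∂_x(ρ u). Then at every point, ∂_t( ρ · (p(ρ) + u − V) ) = 0. In particular, if u(0,x) = V − p(ρ(0,x)) for all x, then ρ·(p(ρ) + u − V) vanishes identically at time 0 and its time derivative vanishes everywhere. -/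
theorem stmt8 (p : ℝ → ℝ) (V : ℝ) (ρ u : ℝ → ℝ → ℝ)
    (hp : Differentiable ℝ p)
    (hρ : ContDiff ℝ 1 (Function.uncurry ρ))
    (hu : ContDiff ℝ 1 (Function.uncurry u))
    (hmass : ∀ t x : ℝ,
      deriv (fun τ => ρ τ x) t + deriv (fun y => ρ t y * u t y) x = 0)
    (hmom : ∀ t x : ℝ,
      deriv (fun τ => ρ τ x * u τ x) t + deriv (fun y => ρ t y * u t y * V) x
        = (ρ t x * deriv p (ρ t x) + p (ρ t x))
            * deriv (fun y => ρ t y * u t y) x) :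
    (∀ t x : ℝ, deriv (fun τ => ρ τ x * (p (ρ τ x) + u τ x - V)) t = 0)
    ∧ ((∀ x : ℝ, u 0 x = V - p (ρ 0 x)) →
        (∀ x : ℝ, ρ 0 x * (p (ρ 0 x) + u 0 x - V) = 0)
        ∧ ∀ t x : ℝ, deriv (fun τ => ρ τ x * (p (ρ τ x) + u τ x - V)) t = 0) := by
  have conserved :
      ∀ t x : ℝ, deriv (fun τ => ρ τ x * (p (ρ τ x) + u τ x - V)) t = 0 := by
    intro t x
    have slice : ∀ f : ℝ → ℝ → ℝ, ContDiff ℝ 1 (Function.uncurry f) →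
        DifferentiableAt ℝ (fun τ => f τ x) t := fun f hf =>
      ((hf.differentiable one_ne_zero).comp
        (differentiable_id.prodMk (differentiable_const x))) t
    have hρt := (slice ρ hρ).hasDerivAt
    have hρut := ((slice ρ hρ).mul (slice u hu)).hasDerivAt
    have hpt := (hp (ρ t x)).hasDerivAt.comp t hρt
    have hsum := ((hρt.mul hpt).add hρut).sub (hρt.mul_const V)
    have hfun : (fun τ => ρ τ x * (p (ρ τ x) + u τ x - V)) =
        fun τ => ρ τ x * p (ρ τ x) + ρ τ x * u τ x - ρ τ x * V := by
      funext τ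
      ring
    have hmass' := hmass t x
    have hmom' := hmom t x
    rw [deriv_mul_const_field] at hmom'
    rw [hfun]
    refine hsum.deriv.trans ?_
    change deriv (fun τ => ρ τ x) t * p (ρ t x) +
      ρ t x * (deriv p (ρ t x) * deriv (fun τ => ρ τ x) t) +
      deriv (fun τ => ρ τ x * u τ x) t - deriv (fun τ => ρ τ x) t * V = 0
    linear_combination
      (p (ρ t x) + ρ t x * deriv p (ρ t x) - V) * hmass' + hmom'
  refine ⟨conserved, fun h0 => ⟨fun x => ?_, conserved⟩⟩
  rw [h0 x]
  ring
end

section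
/- Let p : ℝ → ℝ be differentiable, V ∈ ℝ with V ≠ 0, and let ρ : ℝ → ℝ → ℝ be a continuously differentiable function of (t,x) satisfying at every point ∂_t ρ + ∂_x( ρ·(V − p(ρ)) ) = 0. Define g = ρ·(1 − p(ρ)/V) and s = ρ·p(ρ)/V. Then at every point, ∂_t g + ∂_x(V g) = (ρ p'(ρ) + p(ρ)) · ∂_x g and ∂_t s = −(ρ p'(ρ) + p(ρ)) · ∂_x g. -/
theorem stmt9 (p : ℝ → ℝ) (V : ℝ) (ρ : ℝ → ℝ → ℝ)
    (hp : Differentiable ℝ p) (hV : V ≠ 0)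
    (hρ : ContDiff ℝ 1 (Function.uncurry ρ))
    (heq : ∀ t x : ℝ,
      deriv (fun τ => ρ τ x) t
        + deriv (fun y => ρ t y * (V - p (ρ t y))) x = 0)
    (g s : ℝ → ℝ → ℝ)
    (hg : ∀ t x : ℝ, g t x = ρ t x * (1 - p (ρ t x) / V))
    (hs : ∀ t x : ℝ, s t x = ρ t x * p (ρ t x) / V) :
    ∀ t x : ℝ,
      (deriv (fun τ => g τ x) t + deriv (fun y => V * g t y) x
        = (ρ t x * deriv p (ρ t x) + p (ρ t x)) * deriv (fun y => g t y) x)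
      ∧ (deriv (fun τ => s τ x) t
        = -((ρ t x * deriv p (ρ t x) + p (ρ t x)) * deriv (fun y => g t y) x)) := by
  intro t x
  have hd : Differentiable ℝ (Function.uncurry ρ) := hρ.differentiable (by norm_num)
  have ht : HasDerivAt (fun τ => ρ τ x) (deriv (fun τ => ρ τ x) t) t :=
    (DifferentiableAt.fun_comp' (f := fun τ : ℝ => (τ, x)) t (hd (t, x))
      (by fun_prop)).hasDerivAt
  have hx : HasDerivAt (fun y => ρ t y) (deriv (fun y => ρ t y) x) x :=
    (DifferentiableAt.fun_comp' (f := fun y : ℝ => (t, y)) x (hd (t, x))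
      (by fun_prop)).hasDerivAt
  have hpt : HasDerivAt (fun τ => p (ρ τ x)) _ t := (hp (ρ t x)).hasDerivAt.comp t ht
  have hpx : HasDerivAt (fun y => p (ρ t y)) _ x := (hp (ρ t x)).hasDerivAt.comp x hx
  have hgt := (ht.mul ((hpt.div_const V).const_sub 1)).deriv
  have hgx := hx.mul ((hpx.div_const V).const_sub 1)
  have hst := ((ht.mul hpt).div_const V).deriv
  have hflux := (hx.mul (hpx.const_sub V)).deriv
  have hVgx := (hgx.const_mul V).deriv
  have hgx := hgx.deriv
  have h := heq t x
  simp only [hg, hs]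
  simp only [Pi.mul_def] at hgt hgx hst hflux hVgx
  rw [hflux] at h
  rw [hgt, hgx, hst, hVgx]
  have h' := eq_neg_of_add_eq_zero_left h
  rw [h']
  constructor <;> field_simp <;> ring
end

section
/- Let p : ℝ → ℝ → ℝ be continuously differentiable and let ρ₊, ρ₋, u₊, u₋, w₊ : ℝ → ℝ → ℝ be continuously differentiable functions of (t,x) satisfying at every point ∂_t ρ₊ + ∂_x(ρ₊ u₊) = 0, ∂_t ρ₋ + ∂_x(ρ₋ u₋) = 0, ∂_t(ρ₊ w₊) + ∂_x(ρ₊ w₊ u₊) = 0 and w₊ = u₊ + p(ρ₊, ρ₋). Then at every point, ∂_t(ρ₊ u₊) + ∂_x(ρ₊ u₊ w₊) = ( p(ρ₊,ρ₋) + ρ₊·∂₁p(ρ₊,ρ₋) ) · ∂_x(ρ₊ u₊) + ρ₊·∂₂p(ρ₊,ρ₋) · ∂_x(ρ₋ u₋). -/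
/-- A function of two real variables that is jointly differentiable is differentiable in the
first one. -/
theorem differentiableAt_left_of_uncurry {f : ℝ → ℝ → ℝ} {t x : ℝ}
    (hf : DifferentiableAt ℝ (Function.uncurry f) (t, x)) :
    DifferentiableAt ℝ (fun τ => f τ x) t :=
  hf.comp (f := fun τ : ℝ => (τ, x)) t (by fun_prop)

/-- Chain rule for a function of two real variables along a curve, in terms of its partial
derivatives. -/
theorem hasDerivAt_comp_of_uncurry {p : ℝ → ℝ → ℝ} {a b : ℝ → ℝ} {a' b' t : ℝ}
    (hp : DifferentiableAt ℝ (Function.uncurry p) (a t, b t))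
    (ha : HasDerivAt a a' t) (hb : HasDerivAt b b' t) :
    HasDerivAt (fun τ => p (a τ) (b τ))
      (deriv (fun r => p r (b t)) (a t) * a' + deriv (fun s => p (a t) s) (b t) * b') t := by
  set L := fderiv ℝ (Function.uncurry p) (a t, b t)
  have hL : HasFDerivAt (Function.uncurry p) L (a t, b t) := hp.hasFDerivAt
  have h₁ : deriv (fun r => p r (b t)) (a t) = L (1, 0) :=
    (hL.comp_hasDerivAt (f := fun r : ℝ => (r, b t)) (a t)
      ((hasDerivAt_id (a t)).prodMk (hasDerivAt_const (a t) (b t)))).deriv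
  have h₂ : deriv (fun s => p (a t) s) (b t) = L (0, 1) :=
    (hL.comp_hasDerivAt (f := fun s : ℝ => (a t, s)) (b t)
      ((hasDerivAt_const (b t) (a t)).prodMk (hasDerivAt_id (b t)))).deriv
  have hsplit : L (a', b') = L (1, 0) * a' + L (0, 1) * b' := by
    have : ((a', b') : ℝ × ℝ) = a' • (1, 0) + b' • (0, 1) := by simp
    rw [this, map_add, map_smul, map_smul, smul_eq_mul, smul_eq_mul]
    ring
  rw [h₁, h₂, ← hsplit]
  exact hL.comp_hasDerivAt (f := fun τ => (a τ, b τ)) t (ha.prodMk hb)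


theorem stmt12 (p : ℝ → ℝ → ℝ) (ρp ρm up um wp : ℝ → ℝ → ℝ)
    (hp : ContDiff ℝ 1 (Function.uncurry p))
    (hρp : ContDiff ℝ 1 (Function.uncurry ρp))
    (hρm : ContDiff ℝ 1 (Function.uncurry ρm))
    (hup : ContDiff ℝ 1 (Function.uncurry up))
    (hum : ContDiff ℝ 1 (Function.uncurry um))
    (hwp : ContDiff ℝ 1 (Function.uncurry wp))
    (hmassp : ∀ t x : ℝ,
      deriv (fun τ => ρp τ x) t + deriv (fun y => ρp t y * up t y) x = 0)
    (hmassm : ∀ t x : ℝ,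
      deriv (fun τ => ρm τ x) t + deriv (fun y => ρm t y * um t y) x = 0)
    (hwpeq : ∀ t x : ℝ,
      deriv (fun τ => ρp τ x * wp τ x) t
        + deriv (fun y => ρp t y * wp t y * up t y) x = 0)
    (hclosp : ∀ t x : ℝ, wp t x = up t x + p (ρp t x) (ρm t x)) :
    ∀ t x : ℝ,
      deriv (fun τ => ρp τ x * up τ x) t
        + deriv (fun y => ρp t y * up t y * wp t y) x
      = (p (ρp t x) (ρm t x) + ρp t x * deriv (fun a => p a (ρm t x)) (ρp t x))
          * deriv (fun y => ρp t y * up t y) x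
        + ρp t x * deriv (fun b => p (ρp t x) b) (ρm t x)
          * deriv (fun y => ρm t y * um t y) x := by
  intro t x
  have hρ := (differentiableAt_left_of_uncurry (hρp.differentiable one_ne_zero (t, x))).hasDerivAt
  have hσ := (differentiableAt_left_of_uncurry (hρm.differentiable one_ne_zero (t, x))).hasDerivAt
  have hw := (differentiableAt_left_of_uncurry (hwp.differentiable one_ne_zero (t, x))).hasDerivAt
  have hP := hasDerivAt_comp_of_uncurry (p := p) (hp.differentiable one_ne_zero _) hρ hσ
  have hρw := (hρ.fun_mul hw).deriv
  have hρu : (fun τ => ρp τ x * up τ x)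
      = fun τ => ρp τ x * wp τ x - ρp τ x * p (ρp τ x) (ρm τ x) := by
    funext τ
    rw [hclosp]
    ring
  have hflux : (fun y => ρp t y * up t y * wp t y) = fun y => ρp t y * wp t y * up t y := by
    funext y
    ring
  have hbal := hwpeq t x
  rw [hρw] at hbal
  rw [hρu, hflux, ((hρ.fun_mul hw).fun_sub (hρ.fun_mul hP)).deriv]
  linear_combination hbal
    - (p (ρp t x) (ρm t x) + ρp t x * deriv (fun a => p a (ρm t x)) (ρp t x)) * hmassp t x
    - ρp t x * deriv (fun b => p (ρp t x) b) (ρm t x) * hmassm t x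
end

section
/- Let p : ℝ → ℝ → ℝ be continuously differentiable, V ∈ ℝ, and let ρ₊, ρ₋, u₊, u₋ : ℝ → ℝ → ℝ be continuously differentiable functions of (t,x) satisfying at every point: ∂_t ρ₊ + ∂_x(ρ₊ u₊) = 0, ∂_t ρ₋ + ∂_x(ρ₋ u₋) = 0, ∂_t(ρ₊ u₊) + ∂_x(ρ₊ u₊ V) = (p(ρ₊,ρ₋) + ρ₊∂₁p(ρ₊,ρ₋))·∂_x(ρ₊ u₊) + ρ₊∂₂p(ρ₊,ρ₋)·∂_x(ρ₋ u₋), and ∂_t(ρ₋ u₋) − ∂_x(ρ₋ u₋ V) = −(p(ρ₋,ρ₊) + ρ₋∂₁p(ρ₋,ρ₊))·∂_x(ρ₋ u₋) − ρ₋∂₂p(ρ₋,ρ₊)·∂_x(ρ₊ u₊). Then at every point, ∂_t( ρ₊·(p(ρ₊,ρ₋) + u₊ − V) ) = 0 and ∂_t( ρ₋·(p(ρ₋,ρ₊) − u₋ − V) ) = 0. -/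
/-- Chain rule for a differentiable function of two real variables along a curve,
in terms of the partial derivatives. -/
theorem hasDerivAt_comp_two {p : ℝ → ℝ → ℝ} {f g : ℝ → ℝ} {t f' g' : ℝ}
    (hp : DifferentiableAt ℝ (Function.uncurry p) (f t, g t))
    (hf : HasDerivAt f f' t) (hg : HasDerivAt g g' t) :
    HasDerivAt (fun τ => p (f τ) (g τ))
      (deriv (fun a => p a (g t)) (f t) * f' + deriv (fun b => p (f t) b) (g t) * g') t := by
  set L := fderiv ℝ (Function.uncurry p) (f t, g t)
  have hL : HasFDerivAt (Function.uncurry p) L (f t, g t) := hp.hasFDerivAt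
  have h₁ : HasDerivAt (fun a => p a (g t)) (L (1, 0)) (f t) :=
    hL.comp_hasDerivAt (f := fun a => (a, g t)) (f t) ((hasDerivAt_id (f t)).prodMk (hasDerivAt_const (f t) (g t)))
  have h₂ : HasDerivAt (fun b => p (f t) b) (L (0, 1)) (g t) :=
    hL.comp_hasDerivAt (f := fun b => (f t, b)) (g t) ((hasDerivAt_const (g t) (f t)).prodMk (hasDerivAt_id (g t)))
  have h : HasDerivAt (fun τ => p (f τ) (g τ)) (L (f', g')) t :=
    hL.comp_hasDerivAt (f := fun τ => (f τ, g τ)) t (hf.prodMk hg)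
  have hsplit : L (f', g') = L (1, 0) * f' + L (0, 1) * g' := by
    have : ((f', g') : ℝ × ℝ) = f' • ((1, 0) : ℝ × ℝ) + g' • ((0, 1) : ℝ × ℝ) := by simp
    rw [this, map_add, map_smul, map_smul, smul_eq_mul, smul_eq_mul]
    ring
  rwa [h₁.deriv, h₂.deriv, ← hsplit]

/-- A jointly `C¹` function of two real variables is differentiable in the first one. -/
theorem ContDiff.differentiableAt_left {f : ℝ → ℝ → ℝ}
    (hf : ContDiff ℝ 1 (Function.uncurry f)) (t x : ℝ) :
    DifferentiableAt ℝ (fun τ => f τ x) t :=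
  (hf.differentiable one_ne_zero (t, x)).comp (f := fun τ : ℝ => (τ, x)) t (by fun_prop)

theorem stmt13 (p : ℝ → ℝ → ℝ) (V : ℝ) (ρp ρm up um : ℝ → ℝ → ℝ)
    (hp : ContDiff ℝ 1 (Function.uncurry p))
    (hρp : ContDiff ℝ 1 (Function.uncurry ρp))
    (hρm : ContDiff ℝ 1 (Function.uncurry ρm))
    (hup : ContDiff ℝ 1 (Function.uncurry up))
    (hum : ContDiff ℝ 1 (Function.uncurry um))
    (hmassp : ∀ t x : ℝ,
      deriv (fun τ => ρp τ x) t + deriv (fun y => ρp t y * up t y) x = 0)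
    (hmassm : ∀ t x : ℝ,
      deriv (fun τ => ρm τ x) t + deriv (fun y => ρm t y * um t y) x = 0)
    (hmomp : ∀ t x : ℝ,
      deriv (fun τ => ρp τ x * up τ x) t
        + deriv (fun y => ρp t y * up t y * V) x
      = (p (ρp t x) (ρm t x) + ρp t x * deriv (fun a => p a (ρm t x)) (ρp t x))
          * deriv (fun y => ρp t y * up t y) x
        + ρp t x * deriv (fun b => p (ρp t x) b) (ρm t x)
          * deriv (fun y => ρm t y * um t y) x)
    (hmomm : ∀ t x : ℝ,
      deriv (fun τ => ρm τ x * um τ x) t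
        - deriv (fun y => ρm t y * um t y * V) x
      = -((p (ρm t x) (ρp t x) + ρm t x * deriv (fun a => p a (ρp t x)) (ρm t x))
            * deriv (fun y => ρm t y * um t y) x)
        - ρm t x * deriv (fun b => p (ρm t x) b) (ρp t x)
          * deriv (fun y => ρp t y * up t y) x) :
    ∀ t x : ℝ,
      deriv (fun τ => ρp τ x * (p (ρp τ x) (ρm τ x) + up τ x - V)) t = 0
      ∧ deriv (fun τ => ρm τ x * (p (ρm τ x) (ρp τ x) - um τ x - V)) t = 0 := by
  intro t x
  have dp := (hρp.differentiableAt_left t x).hasDerivAt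
  have dm := (hρm.differentiableAt_left t x).hasDerivAt
  have dup := (hup.differentiableAt_left t x).hasDerivAt
  have dum := (hum.differentiableAt_left t x).hasDerivAt
  have hP := hp.differentiable one_ne_zero
  have hpp := hasDerivAt_comp_two (f := fun τ => ρp τ x) (g := fun τ => ρm τ x)
    (hP (ρp t x, ρm t x)) dp dm
  have hpm := hasDerivAt_comp_two (f := fun τ => ρm τ x) (g := fun τ => ρp τ x)
    (hP (ρm t x, ρp t x)) dm dp
  have mp := hmassp t x
  have mm := hmassm t x
  have qp := hmomp t x
  have qm := hmomm t x
  rw [deriv_mul_const_field, (dp.fun_mul dup).deriv, eq_neg_of_add_eq_zero_right mp,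
    eq_neg_of_add_eq_zero_right mm] at qp
  rw [deriv_mul_const_field, (dm.fun_mul dum).deriv, eq_neg_of_add_eq_zero_right mp,
    eq_neg_of_add_eq_zero_right mm] at qm
  constructor
  · rw [(dp.fun_mul ((hpp.fun_add dup).sub_const V)).deriv]
    linear_combination qp
  · rw [(dm.fun_mul ((hpm.fun_sub dum).sub_const V)).deriv]
    linear_combination -qm
end

section
/- Let c_pp, c_pm, c_mp, c_mm ∈ ℝ, δ > 0, ξ ∈ ℝ, and suppose Δ := (c_pp + c_mm)² − 4·c_pm·c_mp ≥ 0. Define, for s ∈ ℂ, the dispersion function D(s) = (−i·s + i·ξ·c_pp + δ·ξ²)·(−i·s − i·ξ·c_mm + δ·ξ²) − ξ²·c_pm·c_mp. Then D(s) = 0 if and only if s = ξ·λ₊ or s = ξ·λ₋, where λ± = (1/2)·(c_pp − c_mm − 2·i·δ·ξ ± √Δ). Moreover, every root s of D satisfies Im(s) = −δ·ξ² ≤ 0. -/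
open Complex

theorem stmt16 (c_pp c_pm c_mp c_mm δ ξ : ℝ) (hδ : 0 < δ)
    (Δ : ℝ) (hΔdef : Δ = (c_pp + c_mm) ^ 2 - 4 * c_pm * c_mp) (hΔ : 0 ≤ Δ)
    (D : ℂ → ℂ)
    (hD : ∀ s : ℂ, D s =
      (-Complex.I * s + Complex.I * (ξ : ℂ) * (c_pp : ℂ) + (δ : ℂ) * (ξ : ℂ) ^ 2)
        * (-Complex.I * s - Complex.I * (ξ : ℂ) * (c_mm : ℂ) + (δ : ℂ) * (ξ : ℂ) ^ 2)
      - (ξ : ℂ) ^ 2 * (c_pm : ℂ) * (c_mp : ℂ))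
    (lamP lamM : ℂ)
    (hlamP : lamP = (1 / 2 : ℂ) * ((c_pp : ℂ) - (c_mm : ℂ)
      - 2 * Complex.I * (δ : ℂ) * (ξ : ℂ) + (Real.sqrt Δ : ℂ)))
    (hlamM : lamM = (1 / 2 : ℂ) * ((c_pp : ℂ) - (c_mm : ℂ)
      - 2 * Complex.I * (δ : ℂ) * (ξ : ℂ) - (Real.sqrt Δ : ℂ))) :
    (∀ s : ℂ, D s = 0 ↔ s = (ξ : ℂ) * lamP ∨ s = (ξ : ℂ) * lamM)
    ∧ (∀ s : ℂ, D s = 0 → s.im = -δ * ξ ^ 2 ∧ s.im ≤ 0) := by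
  have hsq : (Real.sqrt Δ : ℂ) ^ 2
      = ((c_pp : ℂ) + (c_mm : ℂ)) ^ 2 - 4 * (c_pm : ℂ) * (c_mp : ℂ) := by
    have h := Real.sq_sqrt hΔ
    rw [hΔdef] at h ⊢
    exact_mod_cast h
  have hfactor : ∀ s : ℂ, D s = -((s - ξ * lamP) * (s - ξ * lamM)) := by
    intro s
    rw [hD, hlamP, hlamM]
    linear_combination (-(ξ : ℂ) ^ 2 / 4) * hsq
      + (s ^ 2 - s * ξ * c_pp + s * ξ * c_mm - ξ ^ 2 * c_pp * c_mm + δ ^ 2 * ξ ^ 4) * Complex.I_sq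
  have hroots : ∀ s : ℂ, D s = 0 ↔ s = (ξ : ℂ) * lamP ∨ s = (ξ : ℂ) * lamM := by
    intro s
    rw [hfactor, neg_eq_zero, mul_eq_zero, sub_eq_zero, sub_eq_zero]
  have himP : lamP.im = -δ * ξ := by
    have h : lamP = ((1 / 2 * (c_pp - c_mm + Real.sqrt Δ) : ℝ) : ℂ)
        + ((-δ * ξ : ℝ) : ℂ) * Complex.I := by
      rw [hlamP]; push_cast; ring
    rw [h, Complex.add_im, Complex.ofReal_im, Complex.im_ofReal_mul, Complex.I_im, zero_add, mul_one]
  have himM : lamM.im = -δ * ξ := by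
    have h : lamM = ((1 / 2 * (c_pp - c_mm - Real.sqrt Δ) : ℝ) : ℂ)
        + ((-δ * ξ : ℝ) : ℂ) * Complex.I := by
      rw [hlamM]; push_cast; ring
    rw [h, Complex.add_im, Complex.ofReal_im, Complex.im_ofReal_mul, Complex.I_im, zero_add, mul_one]
  refine ⟨hroots, fun s hs => ?_⟩
  have him : s.im = -δ * ξ ^ 2 := by
    rcases (hroots s).1 hs with rfl | rfl
    · rw [Complex.im_ofReal_mul, himP]; ring
    · rw [Complex.im_ofReal_mul, himM]; ring
  exact ⟨him, by rw [him]; nlinarith [mul_nonneg hδ.le (sq_nonneg ξ)]⟩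
end

section
/- Let c_pp, c_pm, c_mp, c_mm ∈ ℝ, δ > 0, ξ ∈ ℝ, and suppose Δ := (c_pp + c_mm)² − 4·c_pm·c_mp < 0. Define, for s ∈ ℂ, D(s) = (−i·s + i·ξ·c_pp + δ·ξ²)·(−i·s − i·ξ·c_mm + δ·ξ²) − ξ²·c_pm·c_mp. Then D(s) = 0 if and only if s = ξ·λ₊ or s = ξ·λ₋, where λ± = (1/2)·(c_pp − c_mm − 2·i·δ·ξ ± i·√(−Δ)). Moreover, there exists a root s of D with Im(s) > 0 if and only if 0 < |ξ| < √(−Δ)/(2δ). -/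
open Complex

theorem stmt17 (c_pp c_pm c_mp c_mm δ ξ : ℝ) (hδ : 0 < δ)
    (Δ : ℝ) (hΔdef : Δ = (c_pp + c_mm) ^ 2 - 4 * c_pm * c_mp) (hΔ : Δ < 0)
    (D : ℂ → ℂ)
    (hD : ∀ s : ℂ, D s =
      (-Complex.I * s + Complex.I * (ξ : ℂ) * (c_pp : ℂ) + (δ : ℂ) * (ξ : ℂ) ^ 2)
        * (-Complex.I * s - Complex.I * (ξ : ℂ) * (c_mm : ℂ) + (δ : ℂ) * (ξ : ℂ) ^ 2)
      - (ξ : ℂ) ^ 2 * (c_pm : ℂ) * (c_mp : ℂ))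
    (lamP lamM : ℂ)
    (hlamP : lamP = (1 / 2 : ℂ) * ((c_pp : ℂ) - (c_mm : ℂ)
      - 2 * Complex.I * (δ : ℂ) * (ξ : ℂ) + Complex.I * (Real.sqrt (-Δ) : ℂ)))
    (hlamM : lamM = (1 / 2 : ℂ) * ((c_pp : ℂ) - (c_mm : ℂ)
      - 2 * Complex.I * (δ : ℂ) * (ξ : ℂ) - Complex.I * (Real.sqrt (-Δ) : ℂ))) :
    (∀ s : ℂ, D s = 0 ↔ s = (ξ : ℂ) * lamP ∨ s = (ξ : ℂ) * lamM)
    ∧ ((∃ s : ℂ, D s = 0 ∧ 0 < s.im) ↔ (0 < |ξ| ∧ |ξ| < Real.sqrt (-Δ) / (2 * δ))) := by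
  have hroots : ∀ s : ℂ, D s = 0 ↔ s = (ξ : ℂ) * lamP ∨ s = (ξ : ℂ) * lamM := by
    intro s
    have hsq : ((Real.sqrt (-Δ) : ℝ) : ℂ) ^ 2
        = -(((c_pp : ℂ) + c_mm) ^ 2 - 4 * c_pm * c_mp) := by
      rw [← Complex.ofReal_pow, Real.sq_sqrt (by linarith), hΔdef]
      push_cast
      ring
    have hfactor : D s = -((s - ξ * lamP) * (s - ξ * lamM)) := by
      rw [hD, hlamP, hlamM]
      linear_combination
        ((s - ξ * c_pp) * (s + ξ * c_mm) + (δ : ℂ) ^ 2 * ξ ^ 4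
          - (ξ : ℂ) ^ 2 * (Real.sqrt (-Δ) : ℂ) ^ 2 / 4) * Complex.I_sq
          + (ξ : ℂ) ^ 2 / 4 * hsq
    rw [hfactor, neg_eq_zero, mul_eq_zero, sub_eq_zero, sub_eq_zero]
  have himP : ((ξ : ℂ) * lamP).im = ξ * (Real.sqrt (-Δ) - 2 * δ * ξ) / 2 := by
    have : (ξ : ℂ) * lamP = ((ξ * (c_pp - c_mm) / 2 : ℝ) : ℂ)
        + ((ξ * (Real.sqrt (-Δ) - 2 * δ * ξ) / 2 : ℝ) : ℂ) * Complex.I := by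
      rw [hlamP]
      push_cast
      ring
    rw [this, Complex.add_im, Complex.ofReal_im, Complex.im_ofReal_mul, Complex.I_im]
    ring
  have himM : ((ξ : ℂ) * lamM).im = -ξ * (Real.sqrt (-Δ) + 2 * δ * ξ) / 2 := by
    have : (ξ : ℂ) * lamM = ((ξ * (c_pp - c_mm) / 2 : ℝ) : ℂ)
        + ((-ξ * (Real.sqrt (-Δ) + 2 * δ * ξ) / 2 : ℝ) : ℂ) * Complex.I := by
      rw [hlamM]
      push_cast
      ring
    rw [this, Complex.add_im, Complex.ofReal_im, Complex.im_ofReal_mul, Complex.I_im]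
    ring
  have hS : 0 < Real.sqrt (-Δ) := Real.sqrt_pos.mpr (by linarith)
  refine ⟨hroots, ?_⟩
  have hexists : (∃ s : ℂ, D s = 0 ∧ 0 < s.im)
      ↔ 0 < ((ξ : ℂ) * lamP).im ∨ 0 < ((ξ : ℂ) * lamM).im := by
    simp only [hroots, or_and_right, exists_or, exists_eq_left]
  rw [hexists, himP, himM, lt_div_iff₀ (show 0 < 2 * δ by positivity)]
  generalize Real.sqrt (-Δ) = S at hS
  rcases le_total 0 ξ with hξ | hξ
  · rw [abs_of_nonneg hξ]
    constructor
    · rintro (h | h)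
      · have hpos : 0 < ξ * (S - 2 * δ * ξ) := by linarith
        have := pos_of_mul_pos_right hpos hξ
        exact ⟨lt_of_le_of_ne hξ (by rintro rfl; simp at hpos), by linarith⟩
      · have : 0 ≤ ξ * (S + 2 * δ * ξ) := by positivity
        linarith
    · rintro ⟨h0, h1⟩
      have : 0 < ξ * (S - 2 * δ * ξ) := mul_pos h0 (by linarith)
      exact Or.inl (by linarith)
  · rw [abs_of_nonpos hξ]
    have hξ' : 0 ≤ -ξ := by linarith
    constructor
    · rintro (h | h)
      · have : 0 ≤ -ξ * (S + 2 * δ * -ξ) := by positivity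
        linarith
      · have hpos : 0 < -ξ * (S + 2 * δ * ξ) := by linarith
        have := pos_of_mul_pos_right hpos hξ'
        exact ⟨lt_of_le_of_ne hξ' (by intro h0; rw [← h0] at hpos; simp at hpos), by linarith⟩
    · rintro ⟨h0, h1⟩
      have : 0 < -ξ * (S + 2 * δ * ξ) := mul_pos h0 (by linarith)
      exact Or.inr (by linarith)
end
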